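/- arXiv:2506.02332 — 2 statements merged into one kernel-verified Lean document; each statement's English description precedes it below -/
import Mathlib

section
/- For every base b ≥ 2 there exist an infinite set A ⊆ ℕ and a polynomial p ∈ ℚ[x] of degree 2 such that 0 < dim_FS(CE_b(A)) < dim_FS(CE_b(p(A))) < 1. (In the construction one may take p(x) = x², with dim_FS(CE_b(A)) = 1/2 and dim_FS(CE_b(p(A))) = 3/4.) -/
/-- Number of sliding-block occurrences of `w` in `s`:
`N(w,s) = |{i : s[i…i+|w|−1] = w}|`. -/
def slideN {α : Type*} [DecidableEq α] (w s : List α) : ℕ :=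
  ((Finset.range (s.length + 1 - w.length)).filter
    (fun i => ((s.drop i).take w.length) = w)).card

/-- Sliding count probability of `w` in `s`: `P(w,s) = N(w,s)/(|s|−|w|+1)`. -/
noncomputable def slideP {α : Type*} [DecidableEq α] (w s : List α) : ℝ :=
  (slideN w s : ℝ) / ((s.length : ℝ) - (w.length : ℝ) + 1)

/-- `l`-th sliding block entropy of a string, with logarithms base `|α|`.
The convention `0 · log(1/0) = 0` holds automatically since `Real.logb b 0⁻¹ = 0`. -/
noncomputable def slideH {α : Type*} [Fintype α] [DecidableEq α] (l : ℕ) (x : List α) : ℝ :=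
  (1 / (l : ℝ)) * ∑ w : Fin l → α,
    slideP (List.ofFn w) x * Real.logb (Fintype.card α) (slideP (List.ofFn w) x)⁻¹

/-- The prefix `S[0…n]` of a sequence, i.e. its first `n+1` symbols. -/
def pre {α : Type*} (S : ℕ → α) (n : ℕ) : List α := List.ofFn (fun i : Fin (n + 1) => S i)

/-- Finite-state dimension via sliding block entropies:
`dim_FS(S) = inf_{l ≥ 1} liminf_{n→∞} H_l(S[0…n])`. -/
noncomputable def dimFS {α : Type*} [Fintype α] [DecidableEq α] (S : ℕ → α) : ℝ :=
  ⨅ l : ℕ, Filter.liminf (fun n => slideH (l + 1) (pre S n)) Filter.atTop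

/-- Finite-state strong dimension:
`Dim_FS(S) = inf_{l ≥ 1} limsup_{n→∞} H_l(S[0…n])`. -/
noncomputable def DimFS {α : Type*} [Fintype α] [DecidableEq α] (S : ℕ → α) : ℝ :=
  ⨅ l : ℕ, Filter.limsup (fun n => slideH (l + 1) (pre S n)) Filter.atTop
/-- Cumulative lengths of a sequence of lists. -/
def cumLen {α : Type*} (L : ℕ → List α) : ℕ → ℕ
  | 0 => 0
  | m + 1 => cumLen L m + (L m).length

open scoped Classical in
/-- The infinite sequence obtained by concatenating the lists `L 0, L 1, L 2, …`
(a default symbol is used in the degenerate case where the total length is finite). -/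
noncomputable def concatSeq {α : Type*} (dflt : α) (L : ℕ → List α) (k : ℕ) : α :=
  if h : ∃ m, k < cumLen L (m + 1) then
    (L (Nat.find h)).getD (k - cumLen L (Nat.find h)) dflt
  else dflt
/-- Big-endian base-`b` digit string of `n`, as symbols in `Σ_b = Fin b`. -/
def digitsFin (b : ℕ) (hb : 0 < b) (n : ℕ) : List (Fin b) :=
  (Nat.digits b n).reverse.map (fun d => ⟨d % b, Nat.mod_lt d hb⟩)

/-- The base-`b` Copeland–Erdős sequence `CE_b(A)` of an infinite set `A ⊆ ℕ`:
the concatenation of the base-`b` expansions of the elements of `A` in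
increasing order (`Nat.nth (· ∈ A)` enumerates `A` in increasing order). -/
noncomputable def CEseq (b : ℕ) (hb : 0 < b) (A : Set ℕ) : ℕ → Fin b :=
  concatSeq ⟨0, hb⟩ (fun i => digitsFin b hb (Nat.nth (· ∈ A) i))

/-- The base-`b` Copeland–Erdős sequence `CE_b(f(A))` for `f : ℕ → ℝ`:
the concatenation of the base-`b` expansions of the integer parts `⌊f(n)⌋`
for `n ∈ A` in increasing order of `n`. -/
noncomputable def CEseqF (b : ℕ) (hb : 0 < b) (A : Set ℕ) (f : ℕ → ℝ) : ℕ → Fin b :=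
  concatSeq ⟨0, hb⟩ (fun i => digitsFin b hb ⌊f (Nat.nth (· ∈ A) i)⌋₊)

section Auxiliary

open Filter Topology

lemma slideN_append_le {α : Type*} [DecidableEq α] {w : List α} (hw : w ≠ []) (s t : List α) :
    slideN w s + slideN w t ≤ slideN w (s ++ t) := by
  have hl : 0 < w.length := List.length_pos_iff.2 hw
  unfold slideN
  set A := (Finset.range (s.length + 1 - w.length)).filter
    (fun i => ((s.drop i).take w.length) = w)
  set B := (Finset.range (t.length + 1 - w.length)).filter
    (fun i => ((t.drop i).take w.length) = w)
  have hdisj : Disjoint A (B.map (addLeftEmbedding s.length)) := by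
    rw [Finset.disjoint_left]
    intro i hi hi'
    simp only [A, B, Finset.mem_filter, Finset.mem_range, Finset.mem_map,
      addLeftEmbedding_apply] at hi hi'
    obtain ⟨a, _, ha⟩ := hi'
    omega
  rw [← Finset.card_map (addLeftEmbedding s.length) (s := B), ← Finset.card_union_of_disjoint hdisj]
  apply Finset.card_le_card
  intro i hi
  rw [Finset.mem_union] at hi
  rcases hi with hi | hi
  · simp only [A, Finset.mem_filter, Finset.mem_range] at hi
    simp only [Finset.mem_filter, Finset.mem_range, List.length_append]
    refine ⟨by omega, ?_⟩
    rw [List.drop_append_of_le_length (by omega), List.take_append_of_le_length (by simp; omega)]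
    exact hi.2
  · simp only [B, Finset.mem_filter, Finset.mem_range, Finset.mem_map,
      addLeftEmbedding_apply] at hi
    obtain ⟨a, ⟨ha, hw⟩, rfl⟩ := hi
    simp only [Finset.mem_filter, Finset.mem_range, List.length_append]
    refine ⟨by omega, ?_⟩
    rw [List.drop_append]
    simpa [List.drop_eq_nil_of_le] using hw

lemma slideN_self {α : Type*} [DecidableEq α] (w : List α) : slideN w w = 1 := by
  simp [slideN, Finset.filter_singleton]

lemma sum_slideN {α : Type*} [Fintype α] [DecidableEq α] (l : ℕ) (s : List α) :
    ∑ w : Fin l → α, slideN (List.ofFn w) s = s.length + 1 - l := by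
  simp only [slideN, Finset.card_filter, List.length_ofFn]
  rw [Finset.sum_comm]
  rw [Finset.sum_congr rfl (g := fun _ => 1)]
  · simp
  intro i hi
  rw [Finset.mem_range] at hi
  have hlen : ((s.drop i).take l).length = l := by simp; omega
  generalize (s.drop i).take l = x at hlen
  subst hlen
  rw [Finset.sum_eq_single x.get]
  · simp
  · intro w _ hw
    rw [if_neg]
    intro h
    apply hw
    apply List.ofFn_injective
    rw [← h]; simp
  · simp

lemma sum_slideP {α : Type*} [Fintype α] [DecidableEq α] {l : ℕ} {s : List α}
    (h : l ≤ s.length) : ∑ w : Fin l → α, slideP (List.ofFn w) s = 1 := by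
  have h1 : (l : ℝ) ≤ s.length := by exact_mod_cast h
  simp only [slideP, List.length_ofFn]
  rw [← Finset.sum_div, ← Nat.cast_sum, sum_slideN, Nat.cast_sub (by omega), Nat.cast_add]
  rw [div_eq_one_iff_eq (by linarith)]
  push_cast; ring

lemma slideP_nonneg {α : Type*} [DecidableEq α] {w s : List α}
    (h : w.length ≤ s.length) : 0 ≤ slideP w s := by
  have h1 : (w.length : ℝ) ≤ s.length := by exact_mod_cast h
  exact div_nonneg (Nat.cast_nonneg _) (by linarith)

lemma le_slideP {α : Type*} [DecidableEq α] {w s : List α} (hw : w ≠ [])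
    (h : w.length ≤ s.length) {c : ℝ} (hc : c * s.length ≤ slideN w s) : c ≤ slideP w s := by
  have h1 : (w.length : ℝ) ≤ s.length := by exact_mod_cast h
  have hl : (1 : ℝ) ≤ w.length := by exact_mod_cast List.length_pos_iff.2 hw
  rcases le_or_gt c 0 with h0 | h0
  · exact h0.trans (slideP_nonneg h)
  rw [slideP, le_div_iff₀ (by linarith)]
  nlinarith

/-- A probability vector dominating `c` times the uniform one has entropy at least `c` times
the maximal entropy. -/
lemma mul_log_card_le_sum_negMulLog {ι : Type*} [Fintype ι] [Nonempty ι] {P : ι → ℝ}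
    (hsum : ∑ i, P i = 1) {c : ℝ} (hc0 : 0 ≤ c) (hc1 : c < 1)
    (hP : ∀ i, c * (Fintype.card ι : ℝ)⁻¹ ≤ P i) :
    c * Real.log (Fintype.card ι) ≤ ∑ i, Real.negMulLog (P i) := by
  set N : ℝ := (Fintype.card ι : ℝ)
  have hN : 0 < N := by simp [N, Fintype.card_pos]
  let Q : ι → ℝ := fun i => (P i - c * N⁻¹) / (1 - c)
  have hQ0 : ∀ i, 0 ≤ Q i := fun i => div_nonneg (sub_nonneg.2 (hP i)) (by linarith)
  have hQsum : ∑ i, Q i = 1 := by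
    simp only [Q]
    rw [← Finset.sum_div, Finset.sum_sub_distrib, hsum, Finset.sum_const, Finset.card_univ,
      nsmul_eq_mul]
    change (1 - N * (c * N⁻¹)) / (1 - c) = 1
    rw [div_eq_one_iff_eq (by linarith)]
    field_simp
  have hQ1 : ∀ i, Q i ≤ 1 := fun i => by
    rw [← hQsum]
    exact Finset.single_le_sum (fun j _ => hQ0 j) (Finset.mem_univ i)
  have key : ∀ i, c * Real.negMulLog N⁻¹ ≤ Real.negMulLog (P i) := by
    intro i
    have h := Real.concaveOn_negMulLog.2 (x := N⁻¹) (y := Q i) (by simp [hN.le]) (hQ0 i)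
      hc0 (by linarith : 0 ≤ 1 - c) (by ring)
    have h2 : c * N⁻¹ + (1 - c) * Q i = P i := by
      simp only [Q]
      rw [mul_div_cancel₀ _ (by linarith)]
      ring
    simp only [smul_eq_mul, h2] at h
    have := mul_nonneg (by linarith : 0 ≤ 1 - c) (Real.negMulLog_nonneg (hQ0 i) (hQ1 i))
    linarith
  calc c * Real.log N = ∑ i : ι, c * Real.negMulLog N⁻¹ := by
        rw [Finset.sum_const, Finset.card_univ, nsmul_eq_mul]
        change _ = N * _
        rw [Real.negMulLog, Real.log_inv]
        field_simp
    _ ≤ _ := Finset.sum_le_sum fun i _ => key i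

/-- A probability vector with an atom `i₀` has entropy at most
`log 2 + (1 - P i₀) * log (card ι)`. -/
lemma sum_negMulLog_le {ι : Type*} [Fintype ι] [DecidableEq ι] {P : ι → ℝ}
    (h0 : ∀ i, 0 ≤ P i) (hsum : ∑ i, P i = 1) (i₀ : ι) :
    ∑ i, Real.negMulLog (P i) ≤ Real.log 2 + (1 - P i₀) * Real.log (Fintype.card ι) := by
  set N : ℝ := (Fintype.card ι : ℝ) with hNdef
  have hN : 1 ≤ N := by
    rw [hNdef]; exact_mod_cast Fintype.card_pos_iff.2 ⟨i₀⟩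
  let y : ι → ℝ := fun i => if i = i₀ then 1 / 2 else N⁻¹ / 2
  have hy : ∀ i, 0 < y i := fun i => by dsimp only [y]; split_ifs <;> positivity
  have hysum : ∑ i, y i ≤ 1 := by
    have : ∀ i, y i ≤ (if i = i₀ then 1 / 2 else 0) + N⁻¹ / 2 := fun i => by
      have : 0 < N⁻¹ / 2 := by positivity
      dsimp only [y]; split_ifs <;> linarith
    refine (Finset.sum_le_sum fun i _ => this i).trans ?_
    rw [Finset.sum_add_distrib, Finset.sum_ite_eq', Finset.sum_const, Finset.card_univ,
      nsmul_eq_mul, ← hNdef]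
    simp only [Finset.mem_univ, if_true]
    field_simp
    norm_num
  have gibbs : ∀ i, Real.negMulLog (P i) ≤ -(P i * Real.log (y i)) + (y i - P i) := by
    intro i
    rcases (h0 i).eq_or_lt with h | h
    · rw [← h]; simp [(hy i).le]
    · have h1 := Real.log_le_sub_one_of_pos (div_pos (hy i) h)
      rw [Real.log_div (hy i).ne' h.ne'] at h1
      have h2 := mul_le_mul_of_nonneg_left h1 h.le
      have h3 : P i * (y i / P i - 1) = y i - P i := by field_simp
      rw [Real.negMulLog]
      linarith
  have hlog : ∀ i, -(P i * Real.log (y i)) =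
      P i * Real.log 2 + (P i - if i = i₀ then P i else 0) * Real.log N := by
    intro i
    dsimp only [y]
    split_ifs
    · rw [one_div, Real.log_inv]; ring
    · rw [Real.log_div (by positivity) (by norm_num), Real.log_inv]; ring
  calc ∑ i, Real.negMulLog (P i) ≤ ∑ i, (-(P i * Real.log (y i)) + (y i - P i)) :=
        Finset.sum_le_sum fun i _ => gibbs i
    _ = (∑ i, P i) * Real.log 2 + (∑ i, P i - P i₀) * Real.log N + (∑ i, y i - ∑ i, P i) := by
        simp only [hlog]
        rw [Finset.sum_add_distrib, Finset.sum_add_distrib, Finset.sum_sub_distrib,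
          ← Finset.sum_mul, ← Finset.sum_mul, Finset.sum_sub_distrib, Finset.sum_ite_eq']
        simp
    _ ≤ _ := by rw [hsum]; linarith

lemma slideH_eq {α : Type*} [Fintype α] [DecidableEq α] (l : ℕ) (x : List α) :
    slideH l x = (∑ w : Fin l → α, Real.negMulLog (slideP (List.ofFn w) x)) /
      (l * Real.log (Fintype.card α)) := by
  rw [slideH, div_eq_mul_inv (∑ w : Fin l → α, _), mul_comm, Finset.sum_mul, Finset.sum_mul]
  refine Finset.sum_congr rfl fun w _ => ?_
  rw [Real.negMulLog, Real.logb, Real.log_inv]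
  ring

section Entropy

variable {α : Type*} [Fintype α] [DecidableEq α]

lemma le_slideH (hα : 2 ≤ Fintype.card α) {l : ℕ} (hl : 0 < l) {x : List α} (hx : l ≤ x.length)
    {c : ℝ} (hc0 : 0 ≤ c) (hc1 : c < 1)
    (h : ∀ w : Fin l → α, c * ((Fintype.card α : ℝ) ^ l)⁻¹ ≤ slideP (List.ofFn w) x) :
    c ≤ slideH l x := by
  have : Nonempty α := Fintype.card_pos_iff.1 (by omega)
  have hlog : 0 < Real.log (Fintype.card α) := Real.log_pos (by exact_mod_cast hα)
  have hl' : (0 : ℝ) < l := by exact_mod_cast hl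
  rw [slideH_eq, le_div_iff₀ (by positivity)]
  have := mul_log_card_le_sum_negMulLog (sum_slideP hx) hc0 hc1 (by simpa using h)
  simpa using this

lemma slideH_le (hα : 2 ≤ Fintype.card α) {l : ℕ} (hl : 0 < l) {x : List α} (hx : l ≤ x.length)
    (w : Fin l → α) : slideH l x ≤ 1 - slideP (List.ofFn w) x + 1 / l := by
  have hα' : (2 : ℝ) ≤ Fintype.card α := by exact_mod_cast hα
  have hlog : 0 < Real.log (Fintype.card α) := Real.log_pos (by linarith)
  have hlog2 : Real.log 2 ≤ Real.log (Fintype.card α) := Real.log_le_log (by norm_num) hα'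
  have hl' : (0 : ℝ) < l := by exact_mod_cast hl
  rw [slideH_eq, div_le_iff₀ (by positivity)]
  have := sum_negMulLog_le (P := fun w : Fin l → α => slideP (List.ofFn w) x)
    (fun w => slideP_nonneg (by simpa using hx)) (sum_slideP hx) w
  refine this.trans ?_
  have e : (1 - slideP (List.ofFn w) x + 1 / l) * (l * Real.log (Fintype.card α)) =
    Real.log (Fintype.card α) +
      (1 - slideP (List.ofFn w) x) * (l * Real.log (Fintype.card α)) := by
    field_simp; ring
  rw [e]
  simp only [Fintype.card_pi_const, Nat.cast_pow, Real.log_pow]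
  linarith

lemma slideP_le_one {l : ℕ} {x : List α} (hx : l ≤ x.length) (w : Fin l → α) :
    slideP (List.ofFn w) x ≤ 1 := by
  rw [← sum_slideP (α := α) hx]
  exact Finset.single_le_sum (f := fun w : Fin l → α => slideP (List.ofFn w) x)
    (fun j _ => slideP_nonneg (by simpa using hx)) (Finset.mem_univ w)

lemma slideH_nonneg {l : ℕ} {x : List α} (hx : l ≤ x.length) : 0 ≤ slideH l x := by
  rw [slideH_eq]
  refine div_nonneg (Finset.sum_nonneg fun w _ => ?_)
    (mul_nonneg (Nat.cast_nonneg _) (Real.log_natCast_nonneg _))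
  exact Real.negMulLog_nonneg (slideP_nonneg (by simpa using hx)) (slideP_le_one hx w)

@[simp] lemma length_pre {α : Type*} (S : ℕ → α) (n : ℕ) : (pre S n).length = n + 1 := by
  simp [pre]

lemma eventually_le_length_pre {α : Type*} (S : ℕ → α) (l : ℕ) :
    ∀ᶠ n in atTop, l ≤ (pre S n).length := by
  filter_upwards [eventually_ge_atTop l] with n hn
  rw [length_pre]; omega

/-- The word `w` has lower frequency at least `c` in `S`. -/
def HasLowerFreq {α : Type*} [DecidableEq α] (S : ℕ → α) (w : List α) (c : ℝ) : Prop :=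
  ∀ c' < c, ∀ᶠ n in atTop, c' * (pre S n).length ≤ slideN w (pre S n)

lemma isCoboundedUnder_slideH (hα : 2 ≤ Fintype.card α) (S : ℕ → α) (l : ℕ) :
    IsCoboundedUnder (· ≥ ·) atTop fun n => slideH (l + 1) (pre S n) := by
  have : Nonempty α := Fintype.card_pos_iff.1 (by omega)
  refine IsBoundedUnder.isCoboundedUnder_ge ⟨2, ?_⟩
  rw [eventually_map]
  filter_upwards [eventually_le_length_pre S (l + 1)] with n hn
  have w : Fin (l + 1) → α := fun _ => Classical.arbitrary α
  refine (slideH_le hα l.succ_pos hn w).trans ?_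
  have h1 := slideP_nonneg (w := List.ofFn w) (s := pre S n) (by simpa using hn)
  have h2 : 1 / ((l + 1 : ℕ) : ℝ) ≤ 1 := by
    rw [div_le_one (by positivity)]; push_cast; linarith [(Nat.cast_nonneg l : (0 : ℝ) ≤ l)]
  linarith

lemma eventually_slideH_nonneg (S : ℕ → α) (l : ℕ) :
    ∀ᶠ n in atTop, 0 ≤ slideH l (pre S n) := by
  filter_upwards [eventually_le_length_pre S l] with n hn using slideH_nonneg hn

lemma le_dimFS (hα : 2 ≤ Fintype.card α) {S : ℕ → α} {c : ℝ} (hc1 : c < 1)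
    (h : ∀ w : List α, w ≠ [] → HasLowerFreq S w (c * ((Fintype.card α : ℝ) ^ w.length)⁻¹)) :
    c ≤ dimFS S := by
  refine le_ciInf fun l => ?_
  refine le_of_forall_lt fun d hd => ?_
  obtain ⟨e, hde, hec⟩ := exists_between hd
  refine hde.trans_le ?_
  refine (le_max_left e 0).trans ?_
  have hcard : (0 : ℝ) < Fintype.card α := by exact_mod_cast (by omega : 0 < Fintype.card α)
  refine le_liminf_of_le (isCoboundedUnder_slideH hα S l) ?_
  rcases le_or_gt e 0 with he | he
  · rw [max_eq_right he]
    exact eventually_slideH_nonneg S (l + 1)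
  rw [max_eq_left he.le]
  have hall : ∀ᶠ n in atTop, ∀ w : Fin (l + 1) → α,
      e * ((Fintype.card α : ℝ) ^ (l + 1))⁻¹ * (pre S n).length ≤
        slideN (List.ofFn w) (pre S n) := by
    rw [eventually_all]
    intro w
    refine h (List.ofFn w) (by simp) _ ?_
    rw [List.length_ofFn]
    exact mul_lt_mul_of_pos_right hec (by positivity)
  filter_upwards [hall, eventually_le_length_pre S (l + 1)] with n hn hlen
  exact le_slideH hα l.succ_pos hlen he.le (by linarith) fun w =>
    le_slideP (by simp) (by simpa using hlen) (hn w)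

lemma dimFS_le (hα : 2 ≤ Fintype.card α) {S : ℕ → α} (a : α) {t : ℝ}
    (h : ∀ l, 0 < l → HasLowerFreq S (List.replicate l a) t) :
    dimFS S ≤ 1 - t := by
  have hbdd : BddBelow (Set.range fun l : ℕ =>
      liminf (fun n => slideH (l + 1) (pre S n)) atTop) := by
    refine ⟨0, ?_⟩
    rintro _ ⟨l, rfl⟩
    exact le_liminf_of_le (isCoboundedUnder_slideH hα S l) (eventually_slideH_nonneg S (l + 1))
  refine le_of_forall_pos_le_add fun ε hε => ?_
  obtain ⟨l, hl⟩ := exists_nat_one_div_lt (half_pos hε)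
  refine (ciInf_le hbdd l).trans ?_
  refine liminf_le_of_frequently_le ?_ ⟨0, ?_⟩
  · refine Eventually.frequently ?_
    filter_upwards [h (l + 1) l.succ_pos (t - ε / 2) (by linarith),
      eventually_le_length_pre S (l + 1)] with n hn hlen
    have h1 := slideH_le hα l.succ_pos hlen (fun _ => a)
    rw [List.ofFn_const] at h1
    have h2 := le_slideP (by simp) (by simpa using hlen) hn
    push_cast at h1
    linarith
  · rw [eventually_map]
    exact eventually_slideH_nonneg S (l + 1)

end Entropy

section Concat

variable {α : Type*}

lemma cumLen_mono (L : ℕ → List α) : Monotone (cumLen L) :=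
  monotone_nat_of_le_succ fun _ => Nat.le_add_right _ _

lemma concatSeq_cumLen_add (d : α) (L : ℕ → List α) (m r : ℕ) (hr : r < (L m).length) :
    concatSeq d L (cumLen L m + r) = (L m)[r] := by
  classical
  have hm : cumLen L m + r < cumLen L (m + 1) := by rw [cumLen]; omega
  have h : ∃ i, cumLen L m + r < cumLen L (i + 1) := ⟨m, hm⟩
  have hfind : Nat.find h = m := by
    rw [Nat.find_eq_iff]
    refine ⟨hm, fun n hn => ?_⟩
    have := cumLen_mono L (show n + 1 ≤ m by omega)
    omega
  rw [concatSeq, dif_pos h, hfind, Nat.add_sub_cancel_left, List.getD_eq_getElem _ _ hr]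

lemma ofFn_concatSeq_cumLen_succ (d : α) (L : ℕ → List α) (m : ℕ) :
    List.ofFn (fun i : Fin (cumLen L (m + 1)) => concatSeq d L i) =
      List.ofFn (fun i : Fin (cumLen L m) => concatSeq d L i) ++ L m := by
  rw [show cumLen L (m + 1) = cumLen L m + (L m).length from rfl, List.ofFn_add]
  congr 1
  apply List.ext_getElem
  · simp
  · intro r h1 h2
    simpa using concatSeq_cumLen_add d L m r h2

lemma sum_slideN_le_slideN_ofFn [DecidableEq α] (d : α) (L : ℕ → List α) {w : List α}
    (hw : w ≠ []) (m : ℕ) : ∑ i ∈ Finset.range m, slideN w (L i) ≤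
      slideN w (List.ofFn (fun i : Fin (cumLen L m) => concatSeq d L i)) := by
  induction m with
  | zero => simp
  | succ m ih =>
    rw [Finset.sum_range_succ, ofFn_concatSeq_cumLen_succ]
    exact (Nat.add_le_add_right ih _).trans (slideN_append_le hw _ _)

lemma sum_slideN_le_slideN_pre [DecidableEq α] (d : α) (L : ℕ → List α) {w : List α}
    (hw : w ≠ []) {m n : ℕ} (h : cumLen L m ≤ n + 1) : ∑ i ∈ Finset.range m, slideN w (L i) ≤
      slideN w (pre (concatSeq d L) n) := by
  refine (sum_slideN_le_slideN_ofFn d L hw m).trans ?_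
  obtain ⟨r, hr⟩ := Nat.exists_eq_add_of_le h
  have : pre (concatSeq d L) n =
      List.ofFn (fun i : Fin (cumLen L m + r) => concatSeq d L i) := by
    rw [pre, hr]
  rw [this, List.ofFn_add]
  exact le_trans (Nat.le_add_right _ _) (slideN_append_le hw _ _)

lemma mul_succ_le_two_mul_cumLen {L : ℕ → List α} (hL : ∀ i, i + 1 ≤ (L i).length) (m : ℕ) :
    m * (m + 1) ≤ 2 * cumLen L m := by
  induction m with
  | zero => simp
  | succ m ih =>
    have := hL m
    rw [cumLen]
    nlinarith

lemma exists_cumLen_le_lt {L : ℕ → List α} (hL : ∀ i, i + 1 ≤ (L i).length) (n : ℕ) :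
    ∃ m, cumLen L m ≤ n ∧ n < cumLen L (m + 1) := by
  have h : ∃ m, n < cumLen L (m + 1) :=
    ⟨n + 1, by nlinarith [mul_succ_le_two_mul_cumLen hL (n + 1 + 1)]⟩
  classical
  refine ⟨Nat.find h, ?_, Nat.find_spec h⟩
  rcases hm : Nat.find h with _ | m
  · simp [cumLen]
  · exact not_lt.1 (Nat.find_min h (by omega : m < Nat.find h))

/-- In a concatenation of lists of linearly growing lengths, asymptotic lower bounds on the
frequency of a word in the individual lists carry over to the whole sequence. -/
lemma hasLowerFreq_concatSeq [DecidableEq α] (d : α) {L : ℕ → List α} {w : List α} (hw : w ≠ [])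
    (K : ℕ) (hL : ∀ i, i + 1 ≤ (L i).length) (hK : ∀ i, (L i).length ≤ K * (i + 1)) {c : ℝ}
    (h : ∀ c' < c, ∀ᶠ i in atTop, c' * (L i).length ≤ slideN w (L i)) :
    HasLowerFreq (concatSeq d L) w c := by
  intro a ha
  rcases le_or_gt a 0 with ha0 | ha0
  · exact Eventually.of_forall fun n =>
      (mul_nonpos_of_nonpos_of_nonneg ha0 (Nat.cast_nonneg _)).trans (Nat.cast_nonneg _)
  obtain ⟨e, hae, hec⟩ := exists_between ha
  obtain ⟨i₀, hi₀⟩ := eventually_atTop.1 (h e hec)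
  have hsum : ∀ m, i₀ ≤ m → e * cumLen L m - e * cumLen L i₀ ≤
      ((∑ i ∈ Finset.range m, slideN w (L i) : ℕ) : ℝ) := by
    intro m hm
    induction m, hm using Nat.le_induction with
    | base => rw [sub_self]; exact Nat.cast_nonneg _
    | succ m hm ih =>
      have := hi₀ m hm
      rw [Finset.sum_range_succ, cumLen]
      push_cast at ih ⊢
      linarith
  have he : 0 < e := ha0.trans hae
  obtain ⟨M, hM⟩ := exists_nat_gt ((2 * (e * cumLen L i₀) + 2 * (a * K)) / (e - a))
  rw [div_lt_iff₀ (by linarith)] at hM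
  filter_upwards [eventually_ge_atTop (cumLen L (M + i₀ + 1))] with n hn
  obtain ⟨m, hm1, hm2⟩ := exists_cumLen_le_lt hL (n + 1)
  have hMm : M + i₀ + 1 ≤ m := by
    by_contra hcon
    have := cumLen_mono L (show m + 1 ≤ M + i₀ + 1 by omega)
    omega
  have h1 : ((∑ i ∈ Finset.range m, slideN w (L i) : ℕ) : ℝ) ≤
      slideN w (pre (concatSeq d L) n) := by
    exact_mod_cast sum_slideN_le_slideN_pre d L hw hm1
  refine le_trans ?_ h1
  refine le_trans ?_ (hsum m (by omega))
  have h2 : ((pre (concatSeq d L) n).length : ℝ) ≤ cumLen L m + K * (m + 1) := by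
    have := hK m
    rw [cumLen] at hm2
    rw [length_pre]
    exact_mod_cast (by omega : n + 1 ≤ cumLen L m + K * (m + 1))
  have h3 : (m * (m + 1) : ℝ) ≤ 2 * cumLen L m := by
    exact_mod_cast mul_succ_le_two_mul_cumLen hL m
  have h4 : (M : ℝ) ≤ m := by exact_mod_cast (by omega : M ≤ m)
  have h5 := mul_le_mul_of_nonneg_left h2 ha0.le
  have h6 : 2 * (e * cumLen L i₀) + 2 * (a * K) ≤ m * (e - a) :=
    hM.le.trans (mul_le_mul_of_nonneg_right h4 (by linarith))
  have h7 := mul_le_mul_of_nonneg_right h6 (by positivity : (0 : ℝ) ≤ m + 1)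
  have h8 := mul_le_mul_of_nonneg_left h3 (by linarith : 0 ≤ e - a)
  have h9 : 0 ≤ e * cumLen L i₀ * m := by positivity
  linarith

end Concat

section Digits

variable {b : ℕ} (hb : 0 < b)

/-- The big-endian base-`b` expansion of `x` with exactly `m` digits. -/
def fixedDigits : ℕ → ℕ → List (Fin b)
  | 0, _ => []
  | m + 1, x => fixedDigits m (x / b) ++ [⟨x % b, Nat.mod_lt x hb⟩]

@[simp] lemma length_fixedDigits (m x : ℕ) : (fixedDigits hb m x).length = m := by
  induction m generalizing x with
  | zero => rfl
  | succ m ih => simp [fixedDigits, ih]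

lemma fixedDigits_zero_right (m : ℕ) : fixedDigits hb m 0 = List.replicate m ⟨0, hb⟩ := by
  induction m with
  | zero => rfl
  | succ m ih => simp [fixedDigits, ih, List.replicate_succ']

lemma add_pow_succ_mul_div (hb : 0 < b) (x m y : ℕ) :
    (x + b ^ (m + 1) * y) / b = x / b + b ^ m * y := by
  rw [show x + b ^ (m + 1) * y = x + b * (b ^ m * y) by ring, Nat.add_mul_div_left _ _ hb]

lemma add_pow_succ_mul_mod (x m y : ℕ) : (x + b ^ (m + 1) * y) % b = x % b := by
  rw [show x + b ^ (m + 1) * y = x + b * (b ^ m * y) by ring, Nat.add_mul_mod_self_left]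

lemma div_lt_pow_of_lt_pow_succ {x m : ℕ} (hx : x < b ^ (m + 1)) : x / b < b ^ m :=
  Nat.div_lt_of_lt_mul (by rwa [← pow_succ'])

lemma fixedDigits_add_pow_mul (k : ℕ) {m x : ℕ} (hx : x < b ^ m) (y : ℕ) :
    fixedDigits hb (k + m) (x + b ^ m * y) = fixedDigits hb k y ++ fixedDigits hb m x := by
  induction m generalizing x with
  | zero =>
    have : x = 0 := by simpa using hx
    simp [this, fixedDigits]
  | succ m ih =>
    rw [← add_assoc, fixedDigits, fixedDigits]
    simp only [add_pow_succ_mul_div hb, add_pow_succ_mul_mod]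
    rw [ih (div_lt_pow_of_lt_pow_succ hx), List.append_assoc]

lemma fixedDigits_add_of_lt_pow (k : ℕ) {m x : ℕ} (hx : x < b ^ m) :
    fixedDigits hb (k + m) x = List.replicate k ⟨0, hb⟩ ++ fixedDigits hb m x := by
  rw [← fixedDigits_zero_right, ← fixedDigits_add_pow_mul hb k hx, mul_zero, add_zero]

lemma digitsFin_eq_append (hb1 : 1 < b) {n : ℕ} (hn : 0 < n) :
    digitsFin b hb n = digitsFin b hb (n / b) ++ [⟨n % b, Nat.mod_lt n hb⟩] := by
  rw [digitsFin, Nat.digits_def' hb1 hn]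
  simp [digitsFin]

lemma digitsFin_add_pow_mul (hb1 : 1 < b) {m x y : ℕ} (hx : x < b ^ m) (hy : 0 < y) :
    digitsFin b hb (x + b ^ m * y) = digitsFin b hb y ++ fixedDigits hb m x := by
  induction m generalizing x with
  | zero =>
    have : x = 0 := by simpa using hx
    simp [this, fixedDigits]
  | succ m ih =>
    rw [digitsFin_eq_append hb hb1 (by positivity), fixedDigits]
    simp only [add_pow_succ_mul_div hb, add_pow_succ_mul_mod]
    rw [ih (div_lt_pow_of_lt_pow_succ hx), List.append_assoc]

lemma length_digitsFin_le (hb1 : 1 < b) {n k : ℕ} (h : n < b ^ k) :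
    (digitsFin b hb n).length ≤ k := by
  simpa [digitsFin] using (Nat.digits_length_le_iff hb1 n).2 h

lemma exists_fixedDigits_eq (w : List (Fin b)) :
    ∃ x < b ^ w.length, fixedDigits hb w.length x = w := by
  induction w using List.reverseRecOn with
  | nil => exact ⟨0, by simp, rfl⟩
  | append_singleton w d ih =>
    obtain ⟨x, hx, hxw⟩ := ih
    have h1 : ((d : ℕ) + b * x) / b = x := by
      rw [Nat.add_mul_div_left _ _ hb, Nat.div_eq_of_lt d.2, zero_add]
    have h2 : ((d : ℕ) + b * x) % b = d := by
      rw [Nat.add_mul_mod_self_left, Nat.mod_eq_of_lt d.2]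
    refine ⟨d + b * x, ?_, ?_⟩
    · have := d.2
      rw [List.length_append, List.length_singleton, pow_succ']
      nlinarith
    · rw [List.length_append, List.length_singleton, fixedDigits]
      simp only [h1, h2, hxw]

lemma sum_range_mul {M : Type*} [AddCommMonoid M] (f : ℕ → M) (a c : ℕ) :
    ∑ x ∈ Finset.range (a * c), f x =
      ∑ i ∈ Finset.range a, ∑ j ∈ Finset.range c, f (i * c + j) := by
  induction a with
  | zero => simp
  | succ a ih => rw [Finset.sum_range_succ, ← ih, Nat.succ_mul, Finset.sum_range_add]

lemma slideN_append_singleton {α : Type*} [DecidableEq α] {w s : List α} {d : α} (hw : w ≠ []) :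
    slideN w s + (if w <:+ s ++ [d] then 1 else 0) ≤ slideN w (s ++ [d]) := by
  split_ifs with h
  · have hl : 0 < w.length := List.length_pos_iff.2 hw
    obtain ⟨u, hu⟩ := h
    have hlen : u.length + w.length = s.length + 1 := by
      simpa using congrArg List.length hu
    rw [slideN, slideN, ← Finset.card_insert_of_notMem (a := u.length)]
    · apply Finset.card_le_card
      intro i hi
      simp only [Finset.mem_insert, Finset.mem_filter, Finset.mem_range, List.length_append,
        List.length_singleton] at hi ⊢
      rcases hi with rfl | ⟨hi, hi'⟩
      · exact ⟨by omega, by rw [← hu]; simp⟩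
      · refine ⟨by omega, ?_⟩
        rw [List.drop_append_of_le_length (by omega),
          List.take_append_of_le_length (by simp; omega)]
        exact hi'
    · simp only [Finset.mem_filter, Finset.mem_range]
      omega
  · exact le_trans (Nat.le_add_right _ _) (slideN_append_le hw _ _)

/-- Among all words of length `|w| + i`, the word `w` occurs at least `(i + 1) b ^ i` times. -/
lemma le_sum_slideN_fixedDigits {w : List (Fin b)} (hw : w ≠ []) (i : ℕ) :
    (i + 1) * b ^ i ≤
      ∑ x ∈ Finset.range (b ^ (w.length + i)), slideN w (fixedDigits hb (w.length + i) x) := by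
  obtain ⟨W, hW, hWw⟩ := exists_fixedDigits_eq hb w
  induction i with
  | zero =>
    refine le_trans ?_ (Finset.single_le_sum (fun _ _ => Nat.zero_le _)
      (Finset.mem_range.2 hW))
    rw [add_zero, hWw, slideN_self]; simp
  | succ i ih =>
    have hsuffix : b ^ (i + 1) ≤ ∑ x ∈ Finset.range (b ^ (w.length + i) * b),
        if w <:+ fixedDigits hb (w.length + i + 1) x then 1 else 0 := by
      rw [show b ^ (w.length + i) * b = b ^ (i + 1) * b ^ w.length by ring, sum_range_mul]
      calc b ^ (i + 1) = ∑ z ∈ Finset.range (b ^ (i + 1)), 1 := by simp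
        _ ≤ _ := Finset.sum_le_sum fun z _ => ?_
      refine le_trans ?_ (Finset.single_le_sum (fun _ _ => Nat.zero_le _)
        (Finset.mem_range.2 hW))
      rw [if_pos]
      refine ⟨fixedDigits hb (i + 1) z, ?_⟩
      conv_lhs => rw [← hWw]
      rw [← fixedDigits_add_pow_mul hb (i + 1) hW]
      congr 1 <;> ring
    rw [← add_assoc, pow_succ b (w.length + i)]
    calc (i + 1 + 1) * b ^ (i + 1) = ((i + 1) * b ^ i) * b + b ^ (i + 1) := by ring
      _ ≤ (∑ x ∈ Finset.range (b ^ (w.length + i)),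
            slideN w (fixedDigits hb (w.length + i) x)) * b +
          ∑ x ∈ Finset.range (b ^ (w.length + i) * b),
            if w <:+ fixedDigits hb (w.length + i + 1) x then 1 else 0 := by gcongr
      _ = ∑ x ∈ Finset.range (b ^ (w.length + i) * b),
          (slideN w (fixedDigits hb (w.length + i) (x / b)) +
            if w <:+ fixedDigits hb (w.length + i + 1) x then 1 else 0) := by
        rw [Finset.sum_add_distrib, sum_range_mul (fun x => slideN w _), Finset.sum_mul]
        congr 1
        refine Finset.sum_congr rfl fun y _ => ?_
        rw [Finset.sum_congr rfl (g := fun _ => slideN w (fixedDigits hb (w.length + i) y))]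
        · simp [mul_comm]
        · intro d hd
          rw [mul_comm y b, Nat.mul_add_div hb, Nat.div_eq_of_lt (Finset.mem_range.1 hd),
            add_zero]
      _ ≤ _ := Finset.sum_le_sum fun x _ => slideN_append_singleton hw

lemma exists_sum_slideN_le_slideN_fixedDigits (k : ℕ) {g : ℕ → ℕ} (hg : ∀ q, g q < b ^ k)
    (Q : ℕ) : ∃ v < b ^ (k * Q), ∀ w : List (Fin b), w ≠ [] →
      ∑ q ∈ Finset.range Q, slideN w (fixedDigits hb k (g q)) ≤
        slideN w (fixedDigits hb (k * Q) v) := by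
  induction Q with
  | zero => exact ⟨0, by simp, by simp⟩
  | succ Q ih =>
    obtain ⟨v, hv, h⟩ := ih
    refine ⟨v + b ^ (k * Q) * g Q, ?_, fun w hw => ?_⟩
    · have h1 := hg Q
      calc v + b ^ (k * Q) * g Q < b ^ (k * Q) + b ^ (k * Q) * g Q := by gcongr
        _ = b ^ (k * Q) * (g Q + 1) := by ring
        _ ≤ b ^ (k * Q) * b ^ k := by gcongr; exact h1
        _ = b ^ (k * (Q + 1)) := by ring
    · rw [Finset.sum_range_succ, mul_add, mul_one, add_comm (k * Q) k,
        fixedDigits_add_pow_mul hb k hv, add_comm]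
      exact (Nat.add_le_add_left (h w hw) _).trans (slideN_append_le hw _ _)

lemma exists_slideN_fixedDigits_ge {k m : ℕ} (hk : 0 < k) (hm : k * (k * b ^ k) ≤ m) :
    ∃ v < b ^ m, ∀ w : List (Fin b), w ≠ [] →
      ((b : ℝ) ^ w.length)⁻¹ * (1 - w.length / k) * m ≤ slideN w (fixedDigits hb m v) := by
  set J := m / (k * b ^ k) with hJ
  have hpos : 0 < k * b ^ k := by positivity
  obtain ⟨v, hv, h⟩ := exists_sum_slideN_le_slideN_fixedDigits hb k
    (g := fun q => q % b ^ k) (fun q => Nat.mod_lt _ (by positivity)) (J * b ^ k)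
  have hJm : k * (J * b ^ k) ≤ m := by
    have := Nat.div_mul_le_self m (k * b ^ k)
    calc k * (J * b ^ k) = J * (k * b ^ k) := by ring
      _ ≤ m := this
  obtain ⟨r, hr⟩ := Nat.exists_eq_add_of_le' hJm
  refine ⟨v, hv.trans_le (Nat.pow_le_pow_right hb hJm), fun w hw => ?_⟩
  have hN : J * ∑ x ∈ Finset.range (b ^ k), slideN w (fixedDigits hb k x) ≤
      slideN w (fixedDigits hb m v) := by
    rw [hr, fixedDigits_add_of_lt_pow hb r hv]
    refine le_trans ?_ (le_trans (Nat.le_add_left _ _) (slideN_append_le hw _ _))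
    refine le_trans (le_of_eq ?_) (h w hw)
    rw [sum_range_mul]
    symm
    rw [Finset.sum_congr rfl
      (g := fun _ => ∑ x ∈ Finset.range (b ^ k), slideN w (fixedDigits hb k x))]
    · simp
    · intro i _
      refine Finset.sum_congr rfl fun j hj => ?_
      rw [Nat.mul_add_mod_of_lt (Finset.mem_range.1 hj)]
  have hkR : (0 : ℝ) < k := by exact_mod_cast hk
  have hbR : (0 : ℝ) < b := by exact_mod_cast hb
  rcases le_or_gt k w.length with hkl | hkl
  · refine le_trans ?_ (Nat.cast_nonneg _)
    have : (1 : ℝ) - w.length / k ≤ 0 := by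
      rw [sub_nonpos, le_div_iff₀ hkR, one_mul]; exact_mod_cast hkl
    exact mul_nonpos_of_nonpos_of_nonneg
      (mul_nonpos_of_nonneg_of_nonpos (by positivity) this) (Nat.cast_nonneg _)
  obtain ⟨i, rfl⟩ := Nat.exists_eq_add_of_lt hkl
  have hN' : J * ((i + 1 + 1) * b ^ (i + 1)) ≤ slideN w (fixedDigits hb m v) :=
    (Nat.mul_le_mul_left _ (le_sum_slideN_fixedDigits hb hw (i + 1))).trans hN
  have hlt : m ≤ J * ((w.length + i + 1) * b ^ (w.length + i + 1)) +
      (w.length + i + 1) * b ^ (w.length + i + 1) :=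
    (Nat.lt_div_mul_add hpos).le
  refine le_trans ?_ (Nat.cast_le.2 hN')
  have hltR : (m : ℝ) ≤ J * ((w.length + i + 1) * b ^ (w.length + i + 1)) +
      (w.length + i + 1) * b ^ (w.length + i + 1) := by exact_mod_cast hlt
  have hmR : ((w.length + i + 1) * ((w.length + i + 1) * b ^ (w.length + i + 1)) : ℝ) ≤ m := by
    exact_mod_cast hm
  have hl : (1 : ℝ) ≤ w.length := by exact_mod_cast List.length_pos_iff.2 hw
  have hi : (0 : ℝ) ≤ i := Nat.cast_nonneg i
  have hD : (0 : ℝ) ≤ (w.length + i + 1) * b ^ (w.length + i + 1) := by positivity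
  have key : (m : ℝ) * (i + 1) ≤
      J * ((w.length + i + 1) * b ^ (w.length + i + 1)) * (i + 2) := by
    nlinarith
  have hsub : (1 : ℝ) - w.length / ((w.length + i + 1 : ℕ) : ℝ) =
      (i + 1) / (w.length + i + 1) := by
    push_cast; field_simp; ring
  rw [hsub]
  push_cast
  have hPpos : (0 : ℝ) < b ^ w.length := by positivity
  have hk' : (0 : ℝ) < w.length + i + 1 := by positivity
  rw [show ((b : ℝ) ^ w.length)⁻¹ * ((i + 1) / (w.length + i + 1)) * m =
    m * (i + 1) / (b ^ w.length * (w.length + i + 1)) by field_simp, div_le_iff₀ (by positivity)]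
  refine key.trans (le_of_eq ?_)
  ring

lemma tendsto_natLog {B : ℕ} (hB : 1 < B) : Tendsto (Nat.log B) atTop atTop := by
  refine tendsto_atTop.2 fun n => ?_
  filter_upwards [eventually_ge_atTop (B ^ n)] with m hm
  exact Nat.le_log_of_pow_le hB hm

/-- There are `m`-digit strings in which all words have asymptotically the uniform frequency. -/
lemma exists_balanced_fixedDigits (hb1 : 1 < b) : ∃ v : ℕ → ℕ, (∀ m, v m < b ^ m) ∧
    ∀ w : List (Fin b), w ≠ [] → ∀ c < ((b : ℝ) ^ w.length)⁻¹,
      ∀ᶠ m : ℕ in atTop, c * m ≤ slideN w (fixedDigits hb m (v m)) := by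
  have hB : 1 < b ^ 3 := Nat.one_lt_pow (by norm_num) hb1
  have hex : ∀ m, ∃ v < b ^ m, 0 < Nat.log (b ^ 3) m → ∀ w : List (Fin b), w ≠ [] →
      ((b : ℝ) ^ w.length)⁻¹ * (1 - w.length / (Nat.log (b ^ 3) m : ℕ)) * m ≤
        slideN w (fixedDigits hb m v) := by
    intro m
    rcases Nat.eq_zero_or_pos (Nat.log (b ^ 3) m) with h0 | h0
    · exact ⟨0, by positivity, fun h => absurd h (by omega)⟩
    · have hm : m ≠ 0 := by rintro rfl; simp at h0
      set k := Nat.log (b ^ 3) m with hk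
      have hkb : k ≤ b ^ k := (Nat.lt_pow_self hb1).le
      obtain ⟨v, hv, h⟩ := exists_slideN_fixedDigits_ge hb h0 (m := m) (by
        calc k * (k * b ^ k) ≤ b ^ k * (b ^ k * b ^ k) := by gcongr
          _ = (b ^ 3) ^ k := by ring
          _ ≤ m := Nat.pow_log_le_self _ hm)
      exact ⟨v, hv, fun _ => h⟩
  choose v hv h using hex
  refine ⟨v, hv, fun w hw c hc => ?_⟩
  have hlim : Tendsto (fun m : ℕ =>
      ((b : ℝ) ^ w.length)⁻¹ * (1 - w.length / (Nat.log (b ^ 3) m : ℕ))) atTop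
      (𝓝 (((b : ℝ) ^ w.length)⁻¹ * (1 - 0))) := by
    refine Tendsto.const_mul _ (Tendsto.const_sub _ ?_)
    exact (tendsto_natCast_atTop_atTop.comp (tendsto_natLog hB)).const_div_atTop _
  rw [sub_zero, mul_one] at hlim
  filter_upwards [hlim.eventually_const_lt hc,
    (tendsto_natLog hB).eventually_gt_atTop 0] with m h1 h2
  exact (mul_le_mul_of_nonneg_right h1.le (Nat.cast_nonneg m)).trans (h m h2 w hw)

end Digits

section Construction

variable {b : ℕ} (hb : 0 < b)

lemma eventually_mul_length_le {α : Type*} [DecidableEq α] {L : ℕ → List α} {w : List α}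
    {K d : ℕ} (hK : 0 < K) (hlen : ∀ i, (L i).length ≤ K * i + d) {β : ℝ}
    (h : ∀ c < β, ∀ᶠ i : ℕ in atTop, c * i ≤ slideN w (L i)) :
    ∀ c < β / K, ∀ᶠ i in atTop, c * (L i).length ≤ slideN w (L i) := by
  intro c hc
  have hKR : (0 : ℝ) < K := by exact_mod_cast hK
  rcases le_or_gt c 0 with hc0 | hc0
  · exact Eventually.of_forall fun i =>
      (mul_nonpos_of_nonpos_of_nonneg hc0 (Nat.cast_nonneg _)).trans (Nat.cast_nonneg _)
  rw [lt_div_iff₀ hKR] at hc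
  obtain ⟨e, hce, heβ⟩ := exists_between hc
  obtain ⟨M, hM⟩ := exists_nat_gt (c * d / (e - c * K))
  rw [div_lt_iff₀ (by linarith)] at hM
  filter_upwards [h e heβ, eventually_ge_atTop M] with i hi hMi
  have h1 : ((L i).length : ℝ) ≤ K * i + d := by exact_mod_cast hlen i
  have h2 : (M : ℝ) ≤ i := by exact_mod_cast hMi
  have h3 := mul_le_mul_of_nonneg_left h1 hc0.le
  have h4 := mul_le_mul_of_nonneg_right h2 (by linarith : 0 ≤ e - c * K)
  linarith

lemma le_dimFS_concatSeq (hb2 : 2 ≤ b) {v : ℕ → ℕ}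
    (hv : ∀ w : List (Fin b), w ≠ [] → ∀ c < ((b : ℝ) ^ w.length)⁻¹,
      ∀ᶠ m : ℕ in atTop, c * m ≤ slideN w (fixedDigits hb m (v m)))
    {L : ℕ → List (Fin b)} (d₀ : Fin b) {t K d : ℕ} (ht : 0 < t) (htK : t < K)
    (hL : ∀ i, i + 1 ≤ (L i).length) (hlen : ∀ i, (L i).length ≤ K * i + d)
    (h : ∀ w i, w ≠ [] → t * slideN w (fixedDigits hb (i + 2) (v (i + 2))) ≤ slideN w (L i)) :
    (t / K : ℝ) ≤ dimFS (concatSeq d₀ L) := by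
  have htR : (0 : ℝ) < t := by exact_mod_cast ht
  have hKR : (0 : ℝ) < K := by exact_mod_cast ht.trans htK
  have hbR : (0 : ℝ) < b := by exact_mod_cast hb
  refine le_dimFS (by simpa using hb2) ((div_lt_one hKR).2 (by exact_mod_cast htK)) ?_
  intro w hw
  refine hasLowerFreq_concatSeq d₀ hw (K + d) hL (fun i => (hlen i).trans (by nlinarith)) ?_
  have := eventually_mul_length_le (L := L) (w := w) (ht.trans htK) hlen
    (β := t * ((b : ℝ) ^ w.length)⁻¹) ?_
  · rw [Fintype.card_fin]
    convert this using 4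
    ring
  intro c hc
  rw [mul_comm, ← div_lt_iff₀ htR] at hc
  rcases le_or_gt c 0 with hc0 | hc0
  · exact Eventually.of_forall fun i =>
      (mul_nonpos_of_nonpos_of_nonneg hc0 (Nat.cast_nonneg _)).trans (Nat.cast_nonneg _)
  filter_upwards [(tendsto_add_atTop_nat 2).eventually (hv w hw _ hc)] with i hi
  have h1 : (t * slideN w (fixedDigits hb (i + 2) (v (i + 2))) : ℝ) ≤ slideN w (L i) := by
    exact_mod_cast h w i hw
  refine le_trans ?_ h1
  have h2 := mul_le_mul_of_nonneg_left hi htR.le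
  refine le_trans ?_ h2
  push_cast
  rw [show (t : ℝ) * (c / t * (i + 2)) = c * (i + 2) by field_simp]
  nlinarith

lemma dimFS_concatSeq_le {α : Type*} [Fintype α] [DecidableEq α] (hα : 2 ≤ Fintype.card α)
    {L : ℕ → List α} (d₀ a : α) {t K d : ℕ} (ht : 0 < t) (hK : 0 < K)
    (hL : ∀ i, i + 1 ≤ (L i).length) (hlen : ∀ i, (L i).length ≤ K * i + d)
    (h : ∀ l, 0 < l → ∃ D, ∀ i, t * i ≤ slideN (List.replicate l a) (L i) + D) :
    dimFS (concatSeq d₀ L) ≤ 1 - t / K := by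
  have htR : (0 : ℝ) < t := by exact_mod_cast ht
  refine dimFS_le hα a fun l hl => ?_
  refine hasLowerFreq_concatSeq d₀ (by simp; omega) (K + d) hL
    (fun i => (hlen i).trans (by nlinarith)) ?_
  refine eventually_mul_length_le hK hlen fun c hc => ?_
  obtain ⟨D, hD⟩ := h l hl
  obtain ⟨M, hM⟩ := exists_nat_gt ((D : ℝ) / (t - c))
  rw [div_lt_iff₀ (by linarith)] at hM
  filter_upwards [eventually_ge_atTop M] with i hi
  have h1 : (t * i : ℝ) ≤ slideN (List.replicate l a) (L i) + D := by exact_mod_cast hD i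
  have h2 : (M : ℝ) ≤ i := by exact_mod_cast hi
  have h3 := mul_le_mul_of_nonneg_right h2 (by linarith : 0 ≤ t - c)
  linarith

lemma le_slideN_replicate {α : Type*} [DecidableEq α] (l m : ℕ) (a : α) :
    m ≤ slideN (List.replicate l a) (List.replicate m a) + l := by
  have : slideN (List.replicate l a) (List.replicate m a) = m + 1 - l := by
    rw [slideN, Finset.filter_true_of_mem]
    · simp
    · intro i hi
      simp only [List.length_replicate, Finset.mem_range] at hi
      rw [List.drop_replicate, List.take_replicate, List.length_replicate]
      congr 1; omega
  omega

lemma le_slideN_fixedDigits {j x : ℕ} (hx : x < b ^ j) {l : ℕ} (hl : 0 < l) (i : ℕ) :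
    i ≤ slideN (List.replicate l ⟨0, hb⟩) (fixedDigits hb (i + j) x) + l := by
  rw [fixedDigits_add_of_lt_pow hb i hx]
  have h1 := slideN_append_le (w := List.replicate l (⟨0, hb⟩ : Fin b)) (by simp; omega)
    (List.replicate i ⟨0, hb⟩) (fixedDigits hb j x)
  have h2 := le_slideN_replicate l i (⟨0, hb⟩ : Fin b)
  omega

/-- The number `v + 2 (b ^ (3 m) + b ^ (4 m) + b ^ (5 m))`. -/
def sparseNum (b m v : ℕ) : ℕ := v + 2 * (b ^ (3 * m) + b ^ (4 * m) + b ^ (5 * m))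

lemma digitsFin_sparseNum (hb1 : 1 < b) {m v : ℕ} (hm : 2 < b ^ m) (hv : v < b ^ m) :
    digitsFin b hb (sparseNum b m v) = digitsFin b hb 2 ++ fixedDigits hb m 2 ++
      fixedDigits hb m 2 ++ fixedDigits hb (m + m) 0 ++ fixedDigits hb m v := by
  have h : sparseNum b m v =
      v + b ^ m * (0 + b ^ (m + m) * (2 + b ^ m * (2 + b ^ m * 2))) := by
    rw [sparseNum]; ring
  rw [h, digitsFin_add_pow_mul hb hb1 hv (by positivity),
    digitsFin_add_pow_mul hb hb1 (by positivity) (by positivity),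
    digitsFin_add_pow_mul hb hb1 hm (by positivity),
    digitsFin_add_pow_mul hb hb1 hm (by positivity)]

lemma sparseNum_sq_div_four (b m v : ℕ) : sparseNum b m v ^ 2 / 4 =
    v ^ 2 / 4 + b ^ (3 * m) * (v + b ^ m * (v + b ^ m * (v + b ^ m * (1 + b ^ m *
      (2 + 3 * b ^ m + 2 * b ^ (2 * m) + b ^ (3 * m)))))) := by
  rw [sparseNum, ← Nat.add_mul_div_left _ _ (by norm_num : 0 < 4)]
  congr 1
  ring

lemma digitsFin_sparseNum_sq_div_four (hb1 : 1 < b) {m v : ℕ} (hm : 0 < m) (hv : v < b ^ m) :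
    digitsFin b hb (sparseNum b m v ^ 2 / 4) =
      digitsFin b hb (2 + 3 * b ^ m + 2 * b ^ (2 * m) + b ^ (3 * m)) ++ fixedDigits hb m 1 ++
      fixedDigits hb m v ++ fixedDigits hb m v ++ fixedDigits hb m v ++
      fixedDigits hb (3 * m) (v ^ 2 / 4) := by
  have h1 : 1 < b ^ m := Nat.one_lt_pow hm.ne' hb1
  have h2 : v ^ 2 / 4 < b ^ (3 * m) := by
    calc v ^ 2 / 4 ≤ v ^ 2 := Nat.div_le_self _ _
      _ < (b ^ m) ^ 2 := by gcongr
      _ = b ^ (2 * m) := by ring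
      _ ≤ b ^ (3 * m) := Nat.pow_le_pow_right hb (by omega)
  rw [sparseNum_sq_div_four, digitsFin_add_pow_mul hb hb1 h2 (by positivity),
    digitsFin_add_pow_mul hb hb1 hv (by positivity),
    digitsFin_add_pow_mul hb hb1 hv (by positivity),
    digitsFin_add_pow_mul hb hb1 hv (by positivity),
    digitsFin_add_pow_mul hb hb1 h1 (by positivity)]

lemma strictMono_sparseNum (hb1 : 1 < b) {v : ℕ → ℕ} (hv : ∀ m, v m < b ^ m) :
    StrictMono fun m => sparseNum b m (v m) := by
  refine strictMono_nat_of_lt_succ fun m => ?_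
  have hstep : ∀ k, 0 < k → 2 * b ^ (k * m) ≤ b ^ (k * (m + 1)) := by
    intro k hk
    rw [mul_add, mul_one, pow_add, mul_comm]
    exact Nat.mul_le_mul_left _ (hb1.trans_le (Nat.le_self_pow hk.ne' b))
  have h3 := hstep 3 (by norm_num)
  have h4 := hstep 4 (by norm_num)
  have h5 := hstep 5 (by norm_num)
  have hle : b ^ m ≤ b ^ (3 * m) := Nat.pow_le_pow_right (by omega) (by omega)
  have := hv m
  simp only [sparseNum]
  omega

lemma floor_eval_quarter_sq (n : ℕ) :
    ⌊(((Polynomial.C (1 / 4 : ℚ) * Polynomial.X ^ 2).eval (n : ℚ) : ℚ) : ℝ)⌋₊ = n ^ 2 / 4 := by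
  rw [← Nat.floor_div_eq_div (K := ℝ)]
  congr 1
  simp
  ring

lemma nth_mem_range {f : ℕ → ℕ} (hf : StrictMono f) (i : ℕ) :
    Nat.nth (· ∈ Set.range f) i = f i := by
  have hinf : (Set.ofPred (· ∈ Set.range f)).Infinite := Set.infinite_range_of_injective hf.injective
  have h := Nat.range_nth_of_infinite hinf
  exact congrFun (((Nat.nth_strictMono hinf).range_inj hf).1 h) i

end Construction

end Auxiliary

/-- For every base `b ≥ 2` there exist an infinite set `A ⊆ ℕ` and a
polynomial `p ∈ ℚ[x]` of degree 2 such that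
`0 < dim_FS(CE_b(A)) < dim_FS(CE_b(p(A))) < 1`. -/
theorem stmt10 (b : ℕ) (hb : 2 ≤ b) :
    ∃ (A : Set ℕ) (p : Polynomial ℚ), A.Infinite ∧ p.natDegree = 2 ∧
      0 < dimFS (CEseq b (by omega) A) ∧
      dimFS (CEseq b (by omega) A) <
        dimFS (CEseqF b (by omega) A (fun n => ((p.eval (n : ℚ) : ℚ) : ℝ))) ∧
      dimFS (CEseqF b (by omega) A (fun n => ((p.eval (n : ℚ) : ℚ) : ℝ))) < 1 := by
  have hb0 : 0 < b := by omega
  have hb1 : 1 < b := by omega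
  obtain ⟨v, hvlt, hv⟩ := exists_balanced_fixedDigits hb0 hb1
  have hmono : StrictMono fun i => sparseNum b (i + 2) (v (i + 2)) :=
    (strictMono_sparseNum hb1 hvlt).comp (fun i j h => Nat.add_lt_add_right h 2)
  have hcard : 2 ≤ Fintype.card (Fin b) := by simpa using hb
  have h2sq : 2 < b ^ 2 := by nlinarith
  have h2 : ∀ i, 2 < b ^ (i + 2) := fun i =>
    h2sq.trans_le (Nat.pow_le_pow_right hb0 (by omega))
  have hA := fun i => digitsFin_sparseNum hb0 hb1 (h2 i) (hvlt (i + 2))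
  have hP := fun i : ℕ =>
    digitsFin_sparseNum_sq_div_four (m := i + 2) hb0 hb1 (by omega) (hvlt (i + 2))
  have hlenA := fun i => congrArg List.length (hA i)
  have hlenP := fun i => congrArg List.length (hP i)
  simp only [List.length_append, length_fixedDigits] at hlenA hlenP
  have hlen2 : (digitsFin b hb0 2).length ≤ 2 := length_digitsFin_le hb0 hb1 h2sq
  have hlenY : ∀ m, (digitsFin b hb0
      (2 + 3 * b ^ m + 2 * b ^ (2 * m) + b ^ (3 * m))).length ≤ 3 * m + 4 := by
    intro m
    refine length_digitsFin_le hb0 hb1 ?_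
    have e0 : 0 < b ^ (3 * m) := by positivity
    have e1 : b ^ m ≤ b ^ (3 * m) := Nat.pow_le_pow_right hb0 (by omega)
    have e2 : b ^ (2 * m) ≤ b ^ (3 * m) := Nat.pow_le_pow_right hb0 (by omega)
    have e3 : 2 ^ 4 ≤ b ^ 4 := Nat.pow_le_pow_left hb 4
    rw [pow_add]
    nlinarith
  refine ⟨Set.range fun i => sparseNum b (i + 2) (v (i + 2)),
    Polynomial.C (1 / 4) * Polynomial.X ^ 2, Set.infinite_range_of_injective hmono.injective,
    Polynomial.natDegree_C_mul_X_pow 2 _ (by norm_num), ?_⟩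
  simp only [CEseq, CEseqF, nth_mem_range hmono, floor_eval_quarter_sq]
  have lowerA := le_dimFS_concatSeq hb0 hb hv ⟨0, hb0⟩ (t := 1) (K := 5) (d := 12)
    (L := fun i => digitsFin b hb0 (sparseNum b (i + 2) (v (i + 2))))
    (by norm_num) (by norm_num) (fun i => by have := hlenA i; omega)
    (fun i => by have := hlenA i; omega) (fun w i hw => by
      have k1 := slideN_append_le hw (digitsFin b hb0 2 ++ fixedDigits hb0 (i + 2) 2 ++
        fixedDigits hb0 (i + 2) 2 ++ fixedDigits hb0 (i + 2 + (i + 2)) 0)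
        (fixedDigits hb0 (i + 2) (v (i + 2)))
      rw [← hA i] at k1
      omega)
  have upperA := dimFS_concatSeq_le hcard ⟨0, hb0⟩ ⟨0, hb0⟩ (t := 4) (K := 5) (d := 12)
    (L := fun i => digitsFin b hb0 (sparseNum b (i + 2) (v (i + 2))))
    (by norm_num) (by norm_num) (fun i => by have := hlenA i; omega)
    (fun i => by have := hlenA i; omega) (fun l hl => ⟨3 * l, fun i => by
      have hw : List.replicate l (⟨0, hb0⟩ : Fin b) ≠ [] := by simp; omega
      have z1 := le_slideN_fixedDigits hb0 h2sq hl i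
      have z2 := le_slideN_replicate l (i + 2 + (i + 2)) (⟨0, hb0⟩ : Fin b)
      rw [← fixedDigits_zero_right hb0 (i + 2 + (i + 2))] at z2
      have k1 := slideN_append_le hw (digitsFin b hb0 2) (fixedDigits hb0 (i + 2) 2)
      have k2 := slideN_append_le hw (digitsFin b hb0 2 ++ fixedDigits hb0 (i + 2) 2)
        (fixedDigits hb0 (i + 2) 2)
      have k3 := slideN_append_le hw (digitsFin b hb0 2 ++ fixedDigits hb0 (i + 2) 2 ++
        fixedDigits hb0 (i + 2) 2) (fixedDigits hb0 (i + 2 + (i + 2)) 0)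
      have k4 := slideN_append_le hw (digitsFin b hb0 2 ++ fixedDigits hb0 (i + 2) 2 ++
        fixedDigits hb0 (i + 2) 2 ++ fixedDigits hb0 (i + 2 + (i + 2)) 0)
        (fixedDigits hb0 (i + 2) (v (i + 2)))
      rw [← hA i] at k4
      omega⟩)
  have lowerP := le_dimFS_concatSeq hb0 hb hv ⟨0, hb0⟩ (t := 3) (K := 10) (d := 24)
    (L := fun i => digitsFin b hb0 (sparseNum b (i + 2) (v (i + 2)) ^ 2 / 4))
    (by norm_num) (by norm_num) (fun i => by have := hlenP i; omega)
    (fun i => by have := hlenP i; have := hlenY (i + 2); omega) (fun w i hw => by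
      simp only [hP i]
      set F := fixedDigits hb0 (i + 2) (v (i + 2))
      set Y := digitsFin b hb0 _ ++ fixedDigits hb0 (i + 2) 1
      have k1 := slideN_append_le hw Y F
      have k2 := slideN_append_le hw (Y ++ F) F
      have k3 := slideN_append_le hw (Y ++ F ++ F) F
      have k4 := slideN_append_le hw (Y ++ F ++ F ++ F)
        (fixedDigits hb0 (3 * (i + 2)) (v (i + 2) ^ 2 / 4))
      omega)
  have upperP := dimFS_concatSeq_le hcard ⟨0, hb0⟩ ⟨0, hb0⟩ (t := 1) (K := 10) (d := 24)
    (L := fun i => digitsFin b hb0 (sparseNum b (i + 2) (v (i + 2)) ^ 2 / 4))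
    (by norm_num) (by norm_num) (fun i => by have := hlenP i; omega)
    (fun i => by have := hlenP i; have := hlenY (i + 2); omega) (fun l hl => ⟨l, fun i => by
      have hw : List.replicate l (⟨0, hb0⟩ : Fin b) ≠ [] := by simp; omega
      have z1 := le_slideN_fixedDigits hb0 (x := 1) (j := 2) (by omega) hl i
      simp only [hP i]
      set Y := digitsFin b hb0 _
      simp only [List.append_assoc]
      have k1 := slideN_append_le hw Y (fixedDigits hb0 (i + 2) 1 ++
        (fixedDigits hb0 (i + 2) (v (i + 2)) ++ (fixedDigits hb0 (i + 2) (v (i + 2)) ++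
        (fixedDigits hb0 (i + 2) (v (i + 2)) ++
        fixedDigits hb0 (3 * (i + 2)) (v (i + 2) ^ 2 / 4)))))
      have k2 := slideN_append_le hw (fixedDigits hb0 (i + 2) 1)
        (fixedDigits hb0 (i + 2) (v (i + 2)) ++ (fixedDigits hb0 (i + 2) (v (i + 2)) ++
        (fixedDigits hb0 (i + 2) (v (i + 2)) ++
        fixedDigits hb0 (3 * (i + 2)) (v (i + 2) ^ 2 / 4))))
      omega⟩)
  norm_num at lowerA upperA lowerP upperP
  refine ⟨?_, ?_, ?_⟩ <;> linarith
end

section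
/- Let b ≥ 2 and let n ≥ 1 and i ∈ ℕ satisfy 2n < b^i and n² < b^i. Then the base-b digit representation of (b^i + n)² consists of a leading 1, followed by i − |σ_b(2n)| zeros, the digits of 2n, i − |σ_b(n²)| zeros, and the digits of n²; equivalently, in little-endian digit lists, digits_b((b^i + n)²) = digits_b(n²) ++ replicate(i − length(digits_b(n²)), 0) ++ digits_b(2n) ++ replicate(i − length(digits_b(2n)), 0) ++ [1]. -/
/-- Padding the digits of `m < b ^ i` to length `i` and appending the digits of `k` gives the
digits of `m + b ^ i * k`. -/
theorem digits_append_padding_append_digits {b i m k : ℕ} (hb : 1 < b) (hk : 0 < k)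
    (hm : m < b ^ i) :
    Nat.digits b m ++ List.replicate (i - (Nat.digits b m).length) 0 ++ Nat.digits b k =
      Nat.digits b (m + b ^ i * k) := by
  rw [Nat.digits_append_zeroes_append_digits hb hk,
    Nat.add_sub_cancel' ((Nat.digits_length_le_iff hb m).2 hm)]

/-- For `b ≥ 2`, `n ≥ 1` and `i` with `2n < b^i` and `n² < b^i`,
the base-`b` representation of `(b^i + n)²` consists (big-endian) of a leading 1,
then `i − |σ_b(2n)|` zeros, the digits of `2n`, then `i − |σ_b(n²)|` zeros and the
digits of `n²`; in little-endian digit lists: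
`digits_b((b^i + n)²) = digits_b(n²) ++ replicate (i − |digits_b(n²)|) 0
  ++ digits_b(2n) ++ replicate (i − |digits_b(2n)|) 0 ++ [1]`. -/
theorem stmt14 (b n i : ℕ) (hb : 2 ≤ b) (hn : 1 ≤ n)
    (h2n : 2 * n < b ^ i) (hn2 : n ^ 2 < b ^ i) :
    Nat.digits b ((b ^ i + n) ^ 2) =
      Nat.digits b (n ^ 2) ++ List.replicate (i - (Nat.digits b (n ^ 2)).length) 0 ++
      Nat.digits b (2 * n) ++ List.replicate (i - (Nat.digits b (2 * n)).length) 0 ++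
      [1] := by
  have hb1 : 1 < b := hb
  rw [show (b ^ i + n) ^ 2 = n ^ 2 + b ^ i * (2 * n + b ^ i * 1) by ring,
    ← digits_append_padding_append_digits hb1 (by omega) hn2,
    ← digits_append_padding_append_digits hb1 one_pos h2n, Nat.digits_of_lt b 1 one_ne_zero hb1]
  simp only [List.append_assoc]
end
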